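/- arXiv:1608.02923 — 7 statements merged into one kernel-verified Lean document; each statement's English description precedes it below -/
import Mathlib

section
/- Let (⟨X_i, O_i⟩)_{i∈I} be a family of MV-topological spaces and let X = ∏_{i∈I} X_i carry the product MV-topology O_X. Then every canonical projection π_i : X → X_i is continuous, and for every MV-topological space ⟨Y, O_Y⟩ and every family of continuous maps f_i : Y → X_i (i ∈ I) there exists a unique continuous map f : Y → X such that π_i ∘ f = f_i for all i ∈ I. -/
open Set

namespace MVTop

/-- Łukasiewicz truncated sum on the unit interval: `a ⊕ b = min (a + b) 1`. -/
noncomputable def mvAdd (a b : unitInterval) : unitInterval :=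
  ⟨min (a.1 + b.1) 1, ⟨le_min (add_nonneg a.2.1 b.2.1) zero_le_one, min_le_right _ _⟩⟩

/-- Łukasiewicz product on the unit interval: `a ⊙ b = max (a + b - 1) 0`. -/
noncomputable def mvMul (a b : unitInterval) : unitInterval :=
  ⟨max (a.1 + b.1 - 1) 0,
    ⟨le_max_right _ _, max_le (by nlinarith [a.2.1, a.2.2, b.2.1, b.2.2]) zero_le_one⟩⟩

variable {X Y : Type*}

/-- Pointwise truncated sum of fuzzy subsets. -/
noncomputable def fAdd (α β : X → unitInterval) : X → unitInterval := fun x => mvAdd (α x) (β x)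

/-- Pointwise Łukasiewicz product of fuzzy subsets. -/
noncomputable def fMul (α β : X → unitInterval) : X → unitInterval := fun x => mvMul (α x) (β x)

/-- Pointwise minimum of fuzzy subsets. -/
noncomputable def fInf (α β : X → unitInterval) : X → unitInterval := fun x => min (α x) (β x)

/-- Pointwise complement `α* = 1 - α`. -/
noncomputable def fStar (α : X → unitInterval) : X → unitInterval :=
  fun x => unitInterval.symm (α x)

instance : Fact ((0:ℝ) ≤ 1) := ⟨zero_le_one⟩

/-- Pointwise supremum of a family of fuzzy subsets. -/
noncomputable def fSup (Γ : Set (X → unitInterval)) : X → unitInterval :=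
  fun x => ⨆ α ∈ Γ, α x

/-- The constant fuzzy subset `𝟏`. -/
noncomputable def fOne : X → unitInterval := fun _ => 1

/-- The constant fuzzy subset `𝟎`. -/
noncomputable def fZero : X → unitInterval := fun _ => 0

/-- `fNsmul n α` is the `n`-fold truncated sum `α ⊕ ⋯ ⊕ α` (with `fNsmul 0 α = 𝟎`). -/
noncomputable def fNsmul : ℕ → (X → unitInterval) → (X → unitInterval)
  | 0, _ => fZero
  | n + 1, α => fAdd α (fNsmul n α)

/-- Truncated sum `f 0 ⊕ ⋯ ⊕ f (k-1)` of a finite family (empty sum is `𝟎`). -/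
noncomputable def fSumFin : (k : ℕ) → (Fin k → (X → unitInterval)) → (X → unitInterval)
  | 0, _ => fZero
  | k + 1, f => fAdd (f 0) (fSumFin k fun i => f i.succ)

/-- Łukasiewicz product `f 0 ⊙ ⋯ ⊙ f (k-1)` of a finite family (empty product is `𝟏`). -/
noncomputable def fMulFin : (k : ℕ) → (Fin k → (X → unitInterval)) → (X → unitInterval)
  | 0, _ => fOne
  | k + 1, f => fMul (f 0) (fMulFin k fun i => f i.succ)

/-- Pointwise minimum `f 0 ∧ ⋯ ∧ f (k-1)` of a finite family (empty infimum is `𝟏`). -/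
noncomputable def fInfFin : (k : ℕ) → (Fin k → (X → unitInterval)) → (X → unitInterval)
  | 0, _ => fOne
  | k + 1, f => fInf (f 0) (fInfFin k fun i => f i.succ)

/-- `O ⊆ [0,1]^X` is an MV-topology on `X`. -/
structure IsMVTopology (O : Set (X → unitInterval)) : Prop where
  zero_mem : fZero ∈ O
  one_mem : fOne ∈ O
  sSup_mem : ∀ Γ ⊆ O, fSup Γ ∈ O
  add_mem : ∀ o₁ ∈ O, ∀ o₂ ∈ O, fAdd o₁ o₂ ∈ O
  mul_mem : ∀ o₁ ∈ O, ∀ o₂ ∈ O, fMul o₁ o₂ ∈ O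
  inf_mem : ∀ o₁ ∈ O, ∀ o₂ ∈ O, fInf o₁ o₂ ∈ O

/-- Continuity of a map between MV-topological spaces. -/
def MVContinuous (O_X : Set (X → unitInterval)) (O_Y : Set (Y → unitInterval))
    (f : X → Y) : Prop :=
  ∀ α ∈ O_Y, (fun x => α (f x)) ∈ O_X

/-- `Γ` contains an additive covering: finitely many of its elements `α i` and positive
integers `n i` with `n 0 • α 0 ⊕ ⋯ ⊕ n (k-1) • α (k-1) = 𝟏`. -/
def ContainsAdditiveCover (Γ : Set (X → unitInterval)) : Prop :=
  ∃ (k : ℕ) (α : Fin k → X → unitInterval) (n : Fin k → ℕ),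
    (∀ i, α i ∈ Γ) ∧ (∀ i, 0 < n i) ∧ fSumFin k (fun i => fNsmul (n i) (α i)) = fOne

/-- Compactness: every open covering contains an additive covering. -/
def MVCompact (O : Set (X → unitInterval)) : Prop :=
  ∀ Γ ⊆ O, fSup Γ = fOne → ContainsAdditiveCover Γ

/-- The Hausdorff separation property for MV-topologies. -/
def MVHausdorff (O : Set (X → unitInterval)) : Prop :=
  ∀ x y : X, x ≠ y → ∃ ox ∈ O, ∃ oy ∈ O,
    ox x = 1 ∧ oy y = 1 ∧ fInf ox oy = fZero

/-- Zero-dimensionality: every open set is a supremum of clopen fuzzy subsets. -/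
def MVZeroDim (O : Set (X → unitInterval)) : Prop :=
  ∀ o ∈ O, ∃ Γ : Set (X → unitInterval),
    (∀ u ∈ Γ, u ∈ O ∧ fStar u ∈ O) ∧ fSup Γ = o

/-- `GenBase S` is the smallest set containing `S` and closed under `⊕`, `⊙`, `∧`
(the base `B_S` generated by a subbase `S`). -/
inductive GenBase (S : Set (X → unitInterval)) : (X → unitInterval) → Prop
  | base : ∀ α ∈ S, GenBase S α
  | add : ∀ α β, GenBase S α → GenBase S β → GenBase S (fAdd α β)
  | mul : ∀ α β, GenBase S α → GenBase S β → GenBase S (fMul α β)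
  | inf : ∀ α β, GenBase S α → GenBase S β → GenBase S (fInf α β)

/-- `S` is a subbase for the MV-topology `O`. -/
def IsSubbase (O S : Set (X → unitInterval)) : Prop :=
  S ⊆ O ∧ ∀ α ∈ O, ∃ Γ : Set (X → unitInterval),
    (∀ β ∈ Γ, GenBase S β) ∧ fSup Γ = α

/-- `S` is a large subbase for `O`: a subbase closed under the maps `α ↦ nα`, `n ≥ 1`. -/
def IsLargeSubbase (O S : Set (X → unitInterval)) : Prop :=
  IsSubbase O S ∧ ∀ α ∈ S, ∀ n : ℕ, 0 < n → fNsmul n α ∈ S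

/-- `Θ` is a base for the MV-topology `O`. -/
def IsBase (O Θ : Set (X → unitInterval)) : Prop :=
  Θ ⊆ O ∧ ∀ α ∈ O, ∃ Γ ⊆ Θ, fSup Γ = α

/-- The collection `𝔉` of open coverings of `X` containing no additive covering. -/
def MVF (O : Set (X → unitInterval)) : Set (Set (X → unitInterval)) :=
  {Γ | Γ ⊆ O ∧ fSup Γ = fOne ∧ ¬ ContainsAdditiveCover Γ}

/-- `M` is a maximal element of `𝔉` with respect to set inclusion. -/
def IsMaximalIn (M O : Set (X → unitInterval)) : Prop :=
  M ∈ MVF O ∧ ∀ Γ ∈ MVF O, M ⊆ Γ → Γ = M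

variable {I : Type*} {Xf : I → Type*}

/-- The canonical subbase `S = {α ∘ π i : α ∈ O i, i ∈ I}` of the product MV-topology. -/
def ProdSubbase (O : ∀ i, Set (Xf i → unitInterval)) :
    Set ((∀ i, Xf i) → unitInterval) :=
  {β | ∃ i, ∃ α ∈ O i, β = fun x => α (x i)}

/-- The product MV-topology: the smallest MV-topology containing `ProdSubbase O`. -/
def ProductMVTopology (O : ∀ i, Set (Xf i → unitInterval)) :
    Set ((∀ i, Xf i) → unitInterval) :=
  ⋂₀ {T | IsMVTopology T ∧ ProdSubbase O ⊆ T}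


/-- The fuzzy subsets whose pullback along `g` is open form an MV-topology. -/
theorem IsMVTopology.coinduced {X Y : Type*} {O : Set (Y → unitInterval)} (hO : IsMVTopology O)
    (g : Y → X) : IsMVTopology {α : X → unitInterval | (fun y => α (g y)) ∈ O} where
  zero_mem := hO.zero_mem
  one_mem := hO.one_mem
  sSup_mem Γ hΓ := by
    have h : (fun y => fSup Γ (g y)) = fSup ((fun α y => α (g y)) '' Γ) := by
      funext y
      simp only [fSup, iSup_image]
    rw [mem_ofPred_eq, h]
    exact hO.sSup_mem _ (image_subset_iff.2 hΓ)
  add_mem _ h₁ _ h₂ := hO.add_mem _ h₁ _ h₂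
  mul_mem _ h₁ _ h₂ := hO.mul_mem _ h₁ _ h₂
  inf_mem _ h₁ _ h₂ := hO.inf_mem _ h₁ _ h₂

/-- A map into the product is continuous as soon as its components are. -/
theorem MVContinuous.pi {Y I : Type*} {Xf : I → Type*} {O : ∀ i, Set (Xf i → unitInterval)}
    {O_Y : Set (Y → unitInterval)} (hY : IsMVTopology O_Y) {g : Y → ∀ i, Xf i}
    (hg : ∀ i, MVContinuous O_Y (O i) fun y => g y i) :
    MVContinuous O_Y (ProductMVTopology O) g := by
  refine fun α hα => hα _ ⟨hY.coinduced g, ?_⟩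
  rintro _ ⟨i, β, hβ, rfl⟩
  exact hg i β hβ

/-- The product MV-topology, with the canonical projections, is the
categorical product: each projection is continuous, and every family of continuous
maps into the factors factors uniquely through a continuous map into the product. -/
theorem product_universal_property {I : Type*} {Xf : I → Type*}
    (O : ∀ i, Set (Xf i → unitInterval)) (hO : ∀ i, IsMVTopology (O i)) :
    (∀ i, MVContinuous (ProductMVTopology O) (O i) (fun x => x i)) ∧
    ∀ (Y : Type*) (O_Y : Set (Y → unitInterval)), IsMVTopology O_Y →
      ∀ f : ∀ i, Y → Xf i, (∀ i, MVContinuous O_Y (O i) (f i)) →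
        ∃! g : Y → ∀ i, Xf i,
          MVContinuous O_Y (ProductMVTopology O) g ∧ ∀ i, (fun y => g y i) = f i := by
  refine ⟨fun i α hα T hT => hT.2 ⟨i, α, hα, rfl⟩, fun Y O_Y hY f hf => ?_⟩
  refine ⟨fun y i => f i y, ⟨MVContinuous.pi hY hf, fun _ => rfl⟩, ?_⟩
  rintro g ⟨-, hg⟩
  funext y i
  exact congrFun (hg i) y

end MVTop
end

section
/- Let (⟨X_i, O_i⟩)_{i∈I} be a family of compact MV-topological spaces and let X = ∏_{i∈I} X_i carry the product MV-topology. Then every open covering Γ of X consisting solely of fuzzy subsets of the form α ∘ π_i with α ∈ O_i and i ∈ I contains an additive covering. -/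
open Set

namespace MVTop

variable {X Y : Type*}

variable {I : Type*} {Xf : I → Type*}

lemma coe_fNsmul {X : Type*} (n : ℕ) (α : X → unitInterval) (x : X) :
    (fNsmul n α x : ℝ) = min (n * (α x : ℝ)) 1 := by
  induction n with
  | zero => simp [fNsmul, fZero]
  | succ n ih =>
    have h0 : (0 : ℝ) ≤ α x := (α x).2.1
    change min ((α x : ℝ) + (fNsmul n α x : ℝ)) 1 = _
    rw [ih]
    push_cast
    grind

lemma fNsmul_fNsmul {X : Type*} (m n : ℕ) (α : X → unitInterval) :
    fNsmul m (fNsmul n α) = fNsmul (m * n) α := by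
  funext x
  apply Subtype.ext
  rw [coe_fNsmul, coe_fNsmul, coe_fNsmul]
  push_cast
  rcases Nat.eq_zero_or_pos m with rfl | hm
  · simp
  · have hm' : (1 : ℝ) ≤ m := by exact_mod_cast hm
    rw [mul_assoc]
    rcases le_total ((n : ℝ) * (α x : ℝ)) 1 with h | h
    · rw [min_eq_left h]
    · rw [min_eq_right h, min_eq_right (by linarith), min_eq_right (by nlinarith)]

lemma fNsmul_comp {X Y : Type*} (φ : Y → X) (n : ℕ) (α : X → unitInterval) :
    fNsmul n (α ∘ φ) = fNsmul n α ∘ φ := by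
  induction n with
  | zero => rfl
  | succ n ih => rw [fNsmul, ih]; rfl

lemma fSumFin_comp {X Y : Type*} (φ : Y → X) (k : ℕ) (f : Fin k → X → unitInterval) :
    fSumFin k (fun i => f i ∘ φ) = fSumFin k f ∘ φ := by
  induction k with
  | zero => rfl
  | succ k ih => rw [fSumFin, ih fun i => f i.succ]; rfl

lemma IsMVTopology.fNsmul_mem {X : Type*} {O : Set (X → unitInterval)} (hO : IsMVTopology O)
    (n : ℕ) {α : X → unitInterval} (hα : α ∈ O) : fNsmul n α ∈ O := by
  induction n with
  | zero => exact hO.zero_mem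
  | succ n ih => exact hO.add_mem _ hα _ ih

lemma ContainsAdditiveCover.of_comp {X Y : Type*} {Δ : Set (X → unitInterval)}
    {Γ : Set (Y → unitInterval)} (φ : Y → X) (h : ∀ α ∈ Δ, α ∘ φ ∈ Γ)
    (hΔ : ContainsAdditiveCover Δ) : ContainsAdditiveCover Γ := by
  obtain ⟨k, α, n, hα, hn, hsum⟩ := hΔ
  refine ⟨k, fun i => α i ∘ φ, n, fun i => h _ (hα i), hn, ?_⟩
  simp only [fNsmul_comp]
  rw [fSumFin_comp φ k fun i => fNsmul (n i) (α i), hsum]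
  rfl

lemma ContainsAdditiveCover.of_image_fNsmul {X : Type*} {Γ : Set (X → unitInterval)} {m : ℕ}
    (hm : 0 < m) (h : ContainsAdditiveCover (fNsmul m '' Γ)) : ContainsAdditiveCover Γ := by
  obtain ⟨k, α, n, hα, hn, hsum⟩ := h
  choose β hβ hβα using hα
  refine ⟨k, β, fun i => n i * m, hβ, fun i => Nat.mul_pos (hn i) hm, ?_⟩
  simpa only [← hβα, fNsmul_fNsmul] using hsum

/-- In a compact space, open sets that jointly exceed `1/2` at every point contain an additive
covering, even if their supremum is not `𝟏`. -/
lemma MVCompact.containsAdditiveCover_of_half_lt {X : Type*} {O : Set (X → unitInterval)}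
    (hc : MVCompact O) (hO : IsMVTopology O) {Γ : Set (X → unitInterval)} (hΓ : Γ ⊆ O)
    (h : ∀ x, ∃ α ∈ Γ, (1 / 2 : ℝ) < α x) : ContainsAdditiveCover Γ := by
  refine .of_image_fNsmul two_pos (hc _ ?_ ?_)
  · rintro _ ⟨α, hα, rfl⟩
    exact hO.fNsmul_mem 2 (hΓ hα)
  · funext x
    obtain ⟨α, hα, hx⟩ := h x
    have hone : fNsmul 2 α x = 1 := by
      apply Subtype.ext
      rw [coe_fNsmul]
      push_cast
      exact min_eq_right (by linarith)
    refine le_antisymm unitInterval.le_one' ?_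
    change 1 ≤ ⨆ β ∈ fNsmul 2 '' Γ, β x
    rw [← hone]
    exact le_iSup₂_of_le (fNsmul 2 α) (mem_image_of_mem _ hα) le_rfl

/-- every open covering of the product of compact MV-topological spaces
consisting solely of fuzzy subsets of the form `α ∘ π i` contains an additive covering. -/
theorem subbasic_cover_of_product_of_compact {I : Type*} {Xf : I → Type*}
    (O : ∀ i, Set (Xf i → unitInterval)) (hO : ∀ i, IsMVTopology (O i))
    (hc : ∀ i, MVCompact (O i)) (Γ : Set ((∀ i, Xf i) → unitInterval))
    (hΓ : Γ ⊆ ProdSubbase O) (hcov : fSup Γ = fOne) :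
    ContainsAdditiveCover Γ := by
  by_cases h : ∃ i, ∀ y : Xf i, ∃ α ∈ {α | α ∈ O i ∧ α ∘ (fun x => x i) ∈ Γ}, (1 / 2 : ℝ) < α y
  · obtain ⟨i, hi⟩ := h
    exact .of_comp (fun x => x i) (fun α hα => hα.2)
      ((hc i).containsAdditiveCover_of_half_lt (hO i) (fun α hα => hα.1) hi)
  · push Not at h
    choose x hx using h
    let half : unitInterval := ⟨1 / 2, by norm_num, by norm_num⟩
    have hle : fSup Γ x ≤ half := iSup₂_le fun β hβ => by
      obtain ⟨i, α, hα, rfl⟩ := hΓ hβ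
      exact hx i α ⟨hα, hβ⟩
    rw [hcov] at hle
    have : (1 : ℝ) ≤ 1 / 2 := hle
    norm_num at this

end MVTop
end

section
/- Let (⟨X_i, O_i⟩)_{i∈I} be a family of MV-topological spaces, X = ∏_{i∈I} X_i, and let Γ be a set of fuzzy subsets of X, each of the form α ∘ π_i with α ∈ O_i and i ∈ I, such that ⋁Γ = 𝟏. Then there exists an index j ∈ I such that for every x ∈ X_j there is some α ∈ O_j with α ∘ π_j ∈ Γ and α(x) > 0. -/
open Set

namespace MVTop

variable {X Y : Type*}

variable {I : Type*} {Xf : I → Type*}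

/-- if a family of fuzzy subsets of a product, each of the form `α ∘ π i`,
covers the product, then there is an index `j` such that every point of `Xf j` gets
positive value from some `α ∈ O j` with `α ∘ π j ∈ Γ`. -/
theorem exists_index_of_subbasic_cover {I : Type*} {Xf : I → Type*}
    (O : ∀ i, Set (Xf i → unitInterval)) (hO : ∀ i, IsMVTopology (O i))
    (Γ : Set ((∀ i, Xf i) → unitInterval)) (hΓ : Γ ⊆ ProdSubbase O)
    (hcov : fSup Γ = fOne) :
    ∃ j, ∀ x : Xf j, ∃ α ∈ O j, (fun p => α (p j)) ∈ Γ ∧ 0 < α x := by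
  by_contra! h
  choose x hx using h
  have hzero : fSup Γ x = 0 := by
    refine le_antisymm (iSup₂_le fun β hβ => ?_) unitInterval.nonneg'
    obtain ⟨i, α, hα, rfl⟩ := hΓ hβ
    exact hx i α hα hβ
  rw [hcov] at hzero
  exact one_ne_zero hzero

end MVTop
end

section
/- If (⟨X_i, O_i⟩)_{i∈I} is a family of Hausdorff MV-topological spaces, then the product X = ∏_{i∈I} X_i, equipped with the product MV-topology, is a Hausdorff MV-topological space. -/
open Set

namespace MVTop

variable {X Y : Type*}

variable {I : Type*} {Xf : I → Type*}

/-- An intersection of MV-topologies is an MV-topology. -/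
theorem IsMVTopology.sInter {X : Type*} {F : Set (Set (X → unitInterval))}
    (hF : ∀ T ∈ F, IsMVTopology T) : IsMVTopology (⋂₀ F) where
  zero_mem T hT := (hF T hT).zero_mem
  one_mem T hT := (hF T hT).one_mem
  sSup_mem Γ hΓ T hT := (hF T hT).sSup_mem Γ fun _ hα => hΓ hα T hT
  add_mem _ h₁ _ h₂ T hT := (hF T hT).add_mem _ (h₁ T hT) _ (h₂ T hT)
  mul_mem _ h₁ _ h₂ T hT := (hF T hT).mul_mem _ (h₁ T hT) _ (h₂ T hT)
  inf_mem _ h₁ _ h₂ T hT := (hF T hT).inf_mem _ (h₁ T hT) _ (h₂ T hT)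

/-- The canonical projections are continuous for the product MV-topology. -/
theorem mvContinuous_eval {I : Type*} {Xf : I → Type*}
    (O : ∀ i, Set (Xf i → unitInterval)) (i : I) :
    MVContinuous (ProductMVTopology O) (O i) (fun x : ∀ i, Xf i => x i) :=
  fun α hα _ hT => hT.2 ⟨i, α, hα, rfl⟩

/-- the product of Hausdorff MV-topological spaces is a Hausdorff
MV-topological space. -/
theorem product_hausdorff {I : Type*} {Xf : I → Type*}
    (O : ∀ i, Set (Xf i → unitInterval)) (hO : ∀ i, IsMVTopology (O i))
    (hH : ∀ i, MVHausdorff (O i)) :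
    IsMVTopology (ProductMVTopology O) ∧ MVHausdorff (ProductMVTopology O) := by
  refine ⟨IsMVTopology.sInter fun _ hT => hT.1, fun x y hxy => ?_⟩
  obtain ⟨i, hi⟩ := Function.ne_iff.mp hxy
  obtain ⟨ox, hox, oy, hoy, hx, hy, hdisj⟩ := hH i (x i) (y i) hi
  exact ⟨_, mvContinuous_eval O i ox hox, _, mvContinuous_eval O i oy hoy, hx, hy,
    funext fun z => congrFun hdisj (z i)⟩

end MVTop
end

section
/- If (⟨X_i, O_i⟩)_{i∈I} is a family of zero-dimensional MV-topological spaces, then the product X = ∏_{i∈I} X_i, equipped with the product MV-topology, is a zero-dimensional MV-topological space. -/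
open Set

namespace MVTop

variable {X Y : Type*}

variable {I : Type*} {Xf : I → Type*}

theorem fSup_le_iff {Γ : Set (X → unitInterval)} {x : X} {c : unitInterval} :
    fSup Γ x ≤ c ↔ ∀ α ∈ Γ, α x ≤ c :=
  iSup₂_le_iff

theorem le_fSup {Γ : Set (X → unitInterval)} {α : X → unitInterval} (hα : α ∈ Γ) :
    α ≤ fSup Γ :=
  fun x => le_iSup₂ (f := fun (β : X → unitInterval) (_ : β ∈ Γ) => β x) α hα

theorem fStar_fStar (α : X → unitInterval) : fStar (fStar α) = α := by
  funext x
  simp [fStar]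

theorem fStar_fZero : fStar (fZero : X → unitInterval) = fOne := by
  funext x
  simp [fStar, fZero, fOne]

theorem fStar_fOne : fStar (fOne : X → unitInterval) = fZero := by
  funext x
  simp [fStar, fZero, fOne]

theorem fStar_fAdd (α β : X → unitInterval) : fStar (fAdd α β) = fMul (fStar α) (fStar β) := by
  funext x
  apply Subtype.ext
  simp only [fStar, fAdd, fMul, mvAdd, mvMul, unitInterval.coe_symm_eq]
  grind

theorem fStar_fMul (α β : X → unitInterval) : fStar (fMul α β) = fAdd (fStar α) (fStar β) := by
  rw [← fStar_fStar (fAdd _ _), fStar_fAdd, fStar_fStar, fStar_fStar]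

theorem fStar_fInf (α β : X → unitInterval) :
    fStar (fInf α β) = fSup {fStar α, fStar β} := by
  funext x
  apply eq_of_forall_ge_iff
  intro c
  rw [fSup_le_iff]
  simp only [fStar, fInf, mem_insert_iff, mem_singleton_iff, forall_eq_or_imp, forall_eq,
    ← Subtype.coe_le_coe, unitInterval.coe_symm_eq]
  rcases min_cases (α x) (β x) with ⟨h, h'⟩ | ⟨h, h'⟩ <;> rw [h] <;>
    simp only [← Subtype.coe_le_coe, ← Subtype.coe_lt_coe] at h' <;>
    grind

/-- `α` is clopen in `O`: both `α` and its complement are open. -/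
def IsMVClopen (O : Set (X → unitInterval)) (α : X → unitInterval) : Prop :=
  α ∈ O ∧ fStar α ∈ O

namespace IsMVClopen

variable {O : Set (X → unitInterval)} {α β : X → unitInterval}

theorem zero (hO : IsMVTopology O) : IsMVClopen O fZero :=
  ⟨hO.zero_mem, fStar_fZero ▸ hO.one_mem⟩

theorem one (hO : IsMVTopology O) : IsMVClopen O fOne :=
  ⟨hO.one_mem, fStar_fOne ▸ hO.zero_mem⟩

theorem add (hO : IsMVTopology O) (hα : IsMVClopen O α) (hβ : IsMVClopen O β) :
    IsMVClopen O (fAdd α β) :=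
  ⟨hO.add_mem _ hα.1 _ hβ.1, fStar_fAdd α β ▸ hO.mul_mem _ hα.2 _ hβ.2⟩

theorem mul (hO : IsMVTopology O) (hα : IsMVClopen O α) (hβ : IsMVClopen O β) :
    IsMVClopen O (fMul α β) :=
  ⟨hO.mul_mem _ hα.1 _ hβ.1, fStar_fMul α β ▸ hO.add_mem _ hα.2 _ hβ.2⟩

theorem inf (hO : IsMVTopology O) (hα : IsMVClopen O α) (hβ : IsMVClopen O β) :
    IsMVClopen O (fInf α β) :=
  ⟨hO.inf_mem _ hα.1 _ hβ.1,
    fStar_fInf α β ▸ hO.sSup_mem _ (pair_subset hα.2 hβ.2)⟩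

end IsMVClopen

/-- The fuzzy subsets that are suprema of the clopen fuzzy subsets below them. -/
def clopenGenerated (O : Set (X → unitInterval)) : Set (X → unitInterval) :=
  {o | ∀ x c, (∀ u, IsMVClopen O u → u ≤ o → u x ≤ c) → o x ≤ c}

variable {O : Set (X → unitInterval)}

theorem IsMVClopen.mem_clopenGenerated {u : X → unitInterval} (hu : IsMVClopen O u) :
    u ∈ clopenGenerated O :=
  fun _ _ h => h u hu le_rfl

theorem fSup_mem_clopenGenerated {Γ : Set (X → unitInterval)} (hΓ : Γ ⊆ clopenGenerated O) :
    fSup Γ ∈ clopenGenerated O := fun x c h =>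
  fSup_le_iff.2 fun _ hα => hΓ hα x c fun u hu huα => h u hu (huα.trans (le_fSup hα))

theorem mvZeroDim_of_subset_clopenGenerated (h : O ⊆ clopenGenerated O) : MVZeroDim O := by
  intro o ho
  refine ⟨{u | IsMVClopen O u ∧ u ≤ o}, fun u hu => hu.1, funext fun x => le_antisymm ?_ ?_⟩
  · exact fSup_le_iff.2 fun u hu => hu.2 x
  · exact h ho x _ fun u hu huo => le_fSup (show u ∈ {u | IsMVClopen O u ∧ u ≤ o} from ⟨hu, huo⟩) x

theorem exists_clopen_sub_lt (hO : IsMVTopology O) {o : X → unitInterval}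
    (ho : o ∈ clopenGenerated O) (x : X) {ε : ℝ} (hε : 0 < ε) :
    ∃ u, IsMVClopen O u ∧ u ≤ o ∧ (o x : ℝ) - ε < u x := by
  by_contra! h
  have h0 : (0 : ℝ) ≤ o x - ε := by
    simpa [fZero] using h fZero (.zero hO) fun y => (o y).2.1
  have hle : o x ≤ ⟨(o x : ℝ) - ε, h0, by linarith [(o x).2.2]⟩ := ho x _ h
  have : (o x : ℝ) ≤ o x - ε := hle
  linarith

/-- A pointwise operation which is monotone, 1-Lipschitz in each argument and preserves clopens
also preserves suprema of clopens. -/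
theorem map₂_mem_clopenGenerated (hO : IsMVTopology O)
    (f : unitInterval → unitInterval → unitInterval)
    (hmono : ∀ a a' b b', a ≤ a' → b ≤ b' → f a b ≤ f a' b')
    (hlip : ∀ a a' b b', a' ≤ a → b' ≤ b → (f a b : ℝ) ≤ f a' b' + (a - a') + (b - b'))
    (hf : ∀ u v, IsMVClopen O u → IsMVClopen O v → IsMVClopen O fun x => f (u x) (v x))
    {α β : X → unitInterval} (hα : α ∈ clopenGenerated O) (hβ : β ∈ clopenGenerated O) :
    (fun x => f (α x) (β x)) ∈ clopenGenerated O := by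
  intro x c h
  refine le_of_forall_pos_le_add (α := ℝ) fun ε hε => ?_
  obtain ⟨u, hu, huα, hux⟩ := exists_clopen_sub_lt hO hα x (half_pos hε)
  obtain ⟨v, hv, hvβ, hvx⟩ := exists_clopen_sub_lt hO hβ x (half_pos hε)
  have hc : (f (u x) (v x) : ℝ) ≤ c :=
    h _ (hf u v hu hv) fun y => hmono _ _ _ _ (huα y) (hvβ y)
  have := hlip _ _ _ _ (huα x) (hvβ x)
  linarith

theorem isMVTopology_clopenGenerated (hO : IsMVTopology O) :
    IsMVTopology (clopenGenerated O) where
  zero_mem := (IsMVClopen.zero hO).mem_clopenGenerated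
  one_mem := (IsMVClopen.one hO).mem_clopenGenerated
  sSup_mem _ := fSup_mem_clopenGenerated
  add_mem _ h₁ _ h₂ := by
    refine map₂_mem_clopenGenerated hO mvAdd ?_ ?_ (fun _ _ => .add hO) h₁ h₂ <;>
      simp only [mvAdd, ← Subtype.coe_le_coe] <;> grind
  mul_mem _ h₁ _ h₂ := by
    refine map₂_mem_clopenGenerated hO mvMul ?_ ?_ (fun _ _ => .mul hO) h₁ h₂ <;>
      simp only [mvMul, ← Subtype.coe_le_coe] <;> grind
  inf_mem _ h₁ _ h₂ := by
    refine map₂_mem_clopenGenerated hO min (fun _ _ _ _ => min_le_min) ?_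
      (fun _ _ => .inf hO) h₁ h₂
    intro a a' b b' ha hb
    have hcoe (p q : unitInterval) : ((min p q : unitInterval) : ℝ) = min (p : ℝ) q :=
      (Subtype.mono_coe (· ∈ unitInterval)).map_min
    rw [hcoe, hcoe]
    rw [← Subtype.coe_le_coe] at ha hb
    grind

theorem isMVTopology_sInter {𝒯 : Set (Set (X → unitInterval))}
    (h : ∀ T ∈ 𝒯, IsMVTopology T) : IsMVTopology (⋂₀ 𝒯) where
  zero_mem T hT := (h T hT).zero_mem
  one_mem T hT := (h T hT).one_mem
  sSup_mem Γ hΓ T hT := (h T hT).sSup_mem Γ fun _ hα => hΓ hα T hT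
  add_mem _ h₁ _ h₂ T hT := (h T hT).add_mem _ (h₁ T hT) _ (h₂ T hT)
  mul_mem _ h₁ _ h₂ T hT := (h T hT).mul_mem _ (h₁ T hT) _ (h₂ T hT)
  inf_mem _ h₁ _ h₂ T hT := (h T hT).inf_mem _ (h₁ T hT) _ (h₂ T hT)

theorem isMVTopology_product (O : ∀ i, Set (Xf i → unitInterval)) :
    IsMVTopology (ProductMVTopology O) :=
  isMVTopology_sInter fun _ hT => hT.1

theorem comp_proj_mem_product {O : ∀ i, Set (Xf i → unitInterval)} {i : I}
    {α : Xf i → unitInterval} (hα : α ∈ O i) :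
    (fun x : ∀ i, Xf i => α (x i)) ∈ ProductMVTopology O :=
  fun _ hT => hT.2 ⟨i, α, hα, rfl⟩

theorem prodSubbase_subset_clopenGenerated {O : ∀ i, Set (Xf i → unitInterval)}
    (hz : ∀ i, MVZeroDim (O i)) :
    ProdSubbase O ⊆ clopenGenerated (ProductMVTopology O) := by
  rintro _ ⟨i, α, hα, rfl⟩ x c h
  obtain ⟨Γ, hΓ, rfl⟩ := hz i α hα
  exact fSup_le_iff.2 fun u hu => h (fun y => u (y i))
    ⟨comp_proj_mem_product (hΓ u hu).1, comp_proj_mem_product (hΓ u hu).2⟩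
    fun y => le_fSup hu (y i)

/-- the product of zero-dimensional MV-topological spaces is a
zero-dimensional MV-topological space. -/
theorem product_zero_dimensional {I : Type*} {Xf : I → Type*}
    (O : ∀ i, Set (Xf i → unitInterval)) (hO : ∀ i, IsMVTopology (O i))
    (hz : ∀ i, MVZeroDim (O i)) :
    IsMVTopology (ProductMVTopology O) ∧ MVZeroDim (ProductMVTopology O) := by
  have hP := isMVTopology_product O
  exact ⟨hP, mvZeroDim_of_subset_clopenGenerated <| sInter_subset_of_mem
    ⟨isMVTopology_clopenGenerated hP, prodSubbase_subset_clopenGenerated hz⟩⟩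

end MVTop
end

section
/- Let X be a set and let α₁, …, αₙ, β ∈ [0,1]^X be fuzzy subsets such that αᵢ ⊕ β = 𝟏 for every i = 1, …, n. Then (α₁ ⊙ ⋯ ⊙ αₙ) ⊕ nβ = 𝟏, where nβ denotes the n-fold sum β ⊕ ⋯ ⊕ β. -/
open Set

namespace MVTop

variable {X Y : Type*}

variable {I : Type*} {Xf : I → Type*}

theorem fAdd_eq_fOne_iff {X : Type*} {α β : X → unitInterval} :
    fAdd α β = fOne ↔ ∀ x, 1 ≤ (α x : ℝ) + β x := by
  simp [funext_iff, fAdd, fOne, mvAdd, Subtype.ext_iff]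

theorem fAdd_fMul_fAdd_eq_fOne {X : Type*} {α β γ δ : X → unitInterval}
    (h₁ : fAdd α β = fOne) (h₂ : fAdd γ δ = fOne) :
    fAdd (fMul α γ) (fAdd β δ) = fOne := by
  rw [fAdd_eq_fOne_iff] at *
  intro x
  have hmul : (fMul α γ x : ℝ) = max ((α x : ℝ) + γ x - 1) 0 := rfl
  have hadd : (fAdd β δ x : ℝ) = min ((β x : ℝ) + δ x) 1 := rfl
  rw [hmul, hadd]
  grind

/-- if `αᵢ ⊕ β = 𝟏` for every `i = 1, …, n`, then
`(α₁ ⊙ ⋯ ⊙ αₙ) ⊕ nβ = 𝟏`. -/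
theorem mul_add_nsmul_eq_one {X : Type*} (n : ℕ) (hn : 0 < n)
    (α : Fin n → X → unitInterval) (β : X → unitInterval)
    (h : ∀ i, fAdd (α i) β = fOne) :
    fAdd (fMulFin n α) (fNsmul n β) = fOne := by
  clear hn
  induction n with
  | zero => simp [fAdd_eq_fOne_iff, fMulFin, fNsmul, fOne, fZero]
  | succ n ih => exact fAdd_fMul_fAdd_eq_fOne (h 0) (ih _ fun i => h i.succ)

end MVTop
end

section
/- Let O be an MV-topology on a set X and let M be a maximal element, with respect to set inclusion, of the collection 𝔉 of open coverings of X containing no additive covering. Then for every α ∈ O: α ∉ M if and only if there exist a positive integer n and elements β₁, …, β_k ∈ M (repetitions allowed, possibly k = 0) such that nα ⊕ β₁ ⊕ ⋯ ⊕ β_k = 𝟏. -/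
open Set

namespace MVTop

variable {X Y : Type*}

variable {I : Type*} {Xf : I → Type*}

lemma mvAdd_comm (a b : unitInterval) : mvAdd a b = mvAdd b a := by
  simp only [mvAdd, add_comm]

lemma mvAdd_assoc (a b c : unitInterval) : mvAdd (mvAdd a b) c = mvAdd a (mvAdd b c) := by
  have ha := a.2.1
  have hc := c.2.1
  apply Subtype.ext
  simp only [mvAdd]
  grind

lemma mvAdd_zero (a : unitInterval) : mvAdd a 0 = a := by
  apply Subtype.ext
  simpa [mvAdd] using a.2.2

lemma mvAdd_one (a : unitInterval) : mvAdd a 1 = 1 := by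
  apply Subtype.ext
  simpa [mvAdd] using a.2.1

lemma fAdd_comm (α β : X → unitInterval) : fAdd α β = fAdd β α :=
  funext fun _ => mvAdd_comm _ _

lemma fAdd_assoc (α β γ : X → unitInterval) : fAdd (fAdd α β) γ = fAdd α (fAdd β γ) :=
  funext fun _ => mvAdd_assoc _ _ _

lemma fAdd_left_comm (α β γ : X → unitInterval) : fAdd α (fAdd β γ) = fAdd β (fAdd α γ) := by
  rw [← fAdd_assoc, fAdd_comm α, fAdd_assoc]

lemma fAdd_fZero (α : X → unitInterval) : fAdd α fZero = α :=
  funext fun _ => mvAdd_zero _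

lemma fZero_fAdd (α : X → unitInterval) : fAdd fZero α = α := by
  rw [fAdd_comm, fAdd_fZero]

lemma fAdd_fOne (α : X → unitInterval) : fAdd α fOne = fOne :=
  funext fun _ => mvAdd_one _

lemma fNsmul_one (α : X → unitInterval) : fNsmul 1 α = α :=
  fAdd_fZero α

lemma fSup_mono {Γ Δ : Set (X → unitInterval)} (h : Γ ⊆ Δ) : fSup Γ ≤ fSup Δ :=
  fun _ => biSup_mono fun _ hα => h hα

lemma fSup_eq_fOne_of_subset {Γ Δ : Set (X → unitInterval)} (h : Γ ⊆ Δ) (hΓ : fSup Γ = fOne) :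
    fSup Δ = fOne :=
  le_antisymm (fun _ => unitInterval.le_one') (hΓ ▸ fSup_mono h)

/-- A set of fuzzy subsets that contains `𝟎` and is closed under adding elements of `Γ` contains
all finite sums of multiples of elements of `Γ`. -/
lemma fSumFin_fNsmul_mem {Γ S : Set (X → unitInterval)} (h_zero : fZero ∈ S)
    (h_add : ∀ γ ∈ Γ, ∀ σ ∈ S, fAdd γ σ ∈ S) :
    ∀ (k : ℕ) (γ : Fin k → X → unitInterval) (n : Fin k → ℕ), (∀ i, γ i ∈ Γ) →
      fSumFin k (fun i => fNsmul (n i) (γ i)) ∈ S := by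
  have h_nsmul : ∀ (m : ℕ), ∀ γ ∈ Γ, ∀ σ ∈ S, fAdd (fNsmul m γ) σ ∈ S := by
    intro m γ hγ σ hσ
    induction m with
    | zero => simpa only [fNsmul, fZero_fAdd] using hσ
    | succ m ih => simpa only [fNsmul, fAdd_assoc] using h_add γ hγ _ ih
  intro k
  induction k with
  | zero => exact fun _ _ _ => h_zero
  | succ k ih =>
    exact fun γ n hγ => h_nsmul _ _ (hγ 0) _ (ih _ (fun i => n i.succ) fun i => hγ i.succ)

/-- A finite sum of multiples of elements of `insert α M` is a multiple of `α` plus a finite sum of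
elements of `M`. -/
lemma exists_fSumFin_insert_eq {M : Set (X → unitInterval)} {α : X → unitInterval} (k : ℕ)
    (γ : Fin k → X → unitInterval) (n : Fin k → ℕ) (hγ : ∀ i, γ i ∈ insert α M) :
    ∃ (m l : ℕ) (β : Fin l → X → unitInterval), (∀ i, β i ∈ M) ∧
      fSumFin k (fun i => fNsmul (n i) (γ i)) = fAdd (fNsmul m α) (fSumFin l β) := by
  refine fSumFin_fNsmul_mem (Γ := insert α M)
    (S := {σ | ∃ (m l : ℕ) (β : Fin l → X → unitInterval), (∀ i, β i ∈ M) ∧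
      σ = fAdd (fNsmul m α) (fSumFin l β)}) ?_ ?_ k γ n hγ
  · exact ⟨0, 0, Fin.elim0, fun i => i.elim0, (fAdd_fZero _).symm⟩
  · rintro δ hδ _ ⟨m, l, β, hβ, rfl⟩
    rcases hδ with rfl | hδ
    · exact ⟨m + 1, l, β, hβ, (fAdd_assoc _ _ _).symm⟩
    · exact ⟨m, l + 1, Fin.cons δ β, Fin.cases hδ hβ, fAdd_left_comm _ _ _⟩

/-- for a maximal element `M` of `𝔉` and `α ∈ O`: `α ∉ M` iff there are a
positive integer `n` and elements `β₁, …, β_k ∈ M` (repetitions allowed, possibly `k = 0`)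
with `nα ⊕ β₁ ⊕ ⋯ ⊕ β_k = 𝟏`. -/
theorem not_mem_maximal_iff {X : Type*} (O : Set (X → unitInterval))
    (hO : IsMVTopology O) (M : Set (X → unitInterval)) (hM : IsMaximalIn M O)
    (α : X → unitInterval) (hα : α ∈ O) :
    α ∉ M ↔ ∃ (n k : ℕ) (β : Fin k → X → unitInterval),
      0 < n ∧ (∀ i, β i ∈ M) ∧ fAdd (fNsmul n α) (fSumFin k β) = fOne := by
  obtain ⟨⟨hMO, hM_cov, hM_add⟩, hM_max⟩ := hM
  constructor
  · intro h
    have h_cover : ContainsAdditiveCover (insert α M) := by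
      by_contra h_not
      have h_eq := hM_max (insert α M) ⟨insert_subset hα hMO,
        fSup_eq_fOne_of_subset (subset_insert α M) hM_cov, h_not⟩ (subset_insert α M)
      exact h (h_eq ▸ mem_insert α M)
    obtain ⟨k, γ, n, hγ, -, h_sum⟩ := h_cover
    obtain ⟨m, l, β, hβ, h_eq⟩ := exists_fSumFin_insert_eq k γ n hγ
    refine ⟨m + 1, l, β, m.succ_pos, hβ, ?_⟩
    rw [fNsmul, fAdd_assoc, ← h_eq, h_sum, fAdd_fOne]
  · rintro ⟨n, k, β, hn, hβ, h_sum⟩ h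
    refine hM_add ⟨k + 1, Fin.cons α β, Fin.cons n fun _ => 1, Fin.cases h hβ,
      Fin.cases hn fun _ => Nat.one_pos, ?_⟩
    simpa only [fSumFin, Fin.cons_zero, Fin.cons_succ, fNsmul_one] using h_sum

end MVTop
end
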